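/- arXiv:1805.07121 — 3 statements merged into one kernel-verified Lean document; each statement's English description precedes it below -/
import Mathlib

section
/- Let K = ℚ̄ (the algebraic numbers in ℂ). Any morphism φ = (φ_ℤ, φ_K) : ℤ(0) → ℤ(1) in Mod_{ℤ,K} is zero, where ℤ(0) = (ℤ, K, n ↦ n⊗1) and ℤ(1) = (ℤ, K, n ↦ n·(2πi)⊗1). Similarly any morphism ℤ(1) → ℤ(0) is zero. -/
set_option synthInstance.maxHeartbeats 1000000
set_option maxHeartbeats 1000000

open TensorProduct CategoryTheory

/-- An object of the category `Mod_{ℤ,K}`: a triple `(H_ℤ, H_K, ω)` with `H_ℤ` a finitely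
generated abelian group, `H_K` a finite-dimensional `K`-vector space, and
`ω : H_ℤ → H_K ⊗_K ℂ` a group homomorphism. -/
structure PeriodMod (K : Type) [Field K] [Algebra K ℂ] : Type 1 where
  HZ : Type
  [instHZ : AddCommGroup HZ]
  [instFG : AddGroup.FG HZ]
  HK : Type
  [instHKgrp : AddCommGroup HK]
  [instHKmod : Module K HK]
  [instFD : FiniteDimensional K HK]
  ω : HZ →+ (HK ⊗[K] ℂ)

attribute [instance] PeriodMod.instHZ PeriodMod.instFG PeriodMod.instHKgrp
  PeriodMod.instHKmod PeriodMod.instFD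

variable {K : Type} [Field K] [Algebra K ℂ]

/-- A morphism of `Mod_{ℤ,K}`: a pair `(φ_ℤ, φ_K)` such that `(φ_K ⊗ 1_ℂ) ∘ ω = ω' ∘ φ_ℤ`. -/
structure PeriodModHom (M N : PeriodMod K) where
  φZ : M.HZ →+ N.HZ
  φK : M.HK →ₗ[K] N.HK
  compat : ∀ x : M.HZ,
    TensorProduct.map φK (LinearMap.id : ℂ →ₗ[K] ℂ) (M.ω x) = N.ω (φZ x)

theorem PeriodModHom.ext' {M N : PeriodMod K} {f g : PeriodModHom M N}
    (h1 : f.φZ = g.φZ) (h2 : f.φK = g.φK) : f = g := by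
  cases f; cases g; simp_all

instance : Category (PeriodMod K) where
  Hom M N := PeriodModHom M N
  id M :=
    { φZ := AddMonoidHom.id _
      φK := LinearMap.id
      compat := by intro x; rw [TensorProduct.map_id]; rfl }
  comp {M N P} f g :=
    { φZ := g.φZ.comp f.φZ
      φK := g.φK.comp f.φK
      compat := by
        intro x
        have h : (TensorProduct.map (g.φK.comp f.φK) (LinearMap.id : ℂ →ₗ[K] ℂ))
            = (TensorProduct.map g.φK LinearMap.id).comp
                (TensorProduct.map f.φK LinearMap.id) := by
          rw [← TensorProduct.map_comp]; rfl
        rw [h]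
        simp only [LinearMap.comp_apply, AddMonoidHom.comp_apply]
        rw [f.compat x, g.compat (f.φZ x)] }
  id_comp f := PeriodModHom.ext' (by ext x; rfl) (by ext x; rfl)
  comp_id f := PeriodModHom.ext' (by ext x; rfl) (by ext x; rfl)
  assoc f g h := PeriodModHom.ext' (by ext x; rfl) (by ext x; rfl)


instance : AddGroup.FG ℤ :=
  Module.Finite.iff_addGroup_fg.mp inferInstance

/-- The field `ℚ̄` of algebraic numbers inside `ℂ`. -/
noncomputable abbrev Qbar : IntermediateField ℚ ℂ := algebraicClosure ℚ ℂ

open Complex in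
/-- The object `ℤ(q) = (ℤ, ℚ̄, n ↦ n·(2πi)^q ⊗ 1)` of `Mod_{ℤ,ℚ̄}`. -/
noncomputable def Zt (q : ℤ) : PeriodMod ↥Qbar where
  HZ := ℤ
  HK := ↥Qbar
  ω := zmultiplesHom _ ((1 : ↥Qbar) ⊗ₜ[↥Qbar] ((2 * (Real.pi : ℂ) * Complex.I) ^ q))

section PiTranscendental

open Polynomial

/-- A nonzero algebraic number is the root of an integer polynomial not vanishing at zero. -/
theorem exists_int_poly_of_ne_zero {L : Type*} [Field L] [Algebra ℚ L] [FiniteDimensional ℚ L]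
    (b : L) (hb : b ≠ 0) : ∃ f : ℤ[X], f.eval 0 ≠ 0 ∧ aeval b f = 0 := by
  have hint : IsIntegral ℚ b := Algebra.IsIntegral.isIntegral b
  obtain ⟨c, hc, hmap⟩ := IsLocalization.integerNormalization_spec (nonZeroDivisors ℤ)
    (minpoly ℚ b)
  refine ⟨IsLocalization.integerNormalization (nonZeroDivisors ℤ) (minpoly ℚ b), ?_, ?_⟩
  · intro h0
    have h1 := congrArg (eval 0) hmap
    rw [eval_zero_map, h0] at h1
    have h2 : eval 0 (minpoly ℚ b) ≠ 0 := by
      rw [← coeff_zero_eq_eval_zero]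
      exact minpoly.coeff_zero_ne_zero hint hb
    have h3 : c ≠ 0 := nonZeroDivisors.ne_zero hc
    simp [h3, h2] at h1
  · have h1 := congrArg (aeval b) hmap
    rw [aeval_map_algebraMap] at h1
    rw [h1]
    simp

/-- The arithmetic core of the Lindemann argument. -/
theorem lindemann_core {L : Type*} [Field L] [Algebra ℚ L] [FiniteDimensional ℚ L]
    [IsGalois ℚ L] (ι : L →ₐ[ℚ] ℂ) {J : Type*} (s : Finset J) (b : J → L)
    (hb : ∀ j ∈ s, b j ≠ 0)
    (hinv : ∀ σ : L ≃ₐ[ℚ] L, ∃ e : J ≃ J, (∀ j, j ∈ s ↔ e j ∈ s) ∧ ∀ j, b (e j) = σ (b j))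
    (k : ℕ) (hk : 0 < k) (hsum : (k : ℂ) + ∑ j ∈ s, Complex.exp (ι (b j)) = 0) : False := by
  classical
  have hpoly : ∀ j, ∃ f : ℤ[X], f.eval 0 ≠ 0 ∧ (j ∈ s → aeval (b j) f = 0) := by
    intro j
    by_cases hj : j ∈ s
    · obtain ⟨f, h1, h2⟩ := exists_int_poly_of_ne_zero (b j) (hb j hj)
      exact ⟨f, h1, fun _ => h2⟩
    · exact ⟨1, by simp, fun h => absurd h hj⟩
  choose F hF0 hFr using hpoly
  set f : ℤ[X] := ∏ j ∈ s, F j with hf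
  have hf0 : f.eval 0 ≠ 0 := by
    rw [hf, eval_prod]
    exact Finset.prod_ne_zero_iff.mpr fun j _ => hF0 j
  have hfne : f ≠ 0 := by
    rintro h
    exact hf0 (by rw [h, eval_zero])
  have hroot : ∀ j ∈ s, ι (b j) ∈ f.aroots ℂ := by
    intro j hj
    rw [mem_aroots]
    refine ⟨hfne, ?_⟩
    have h1 : aeval (b j) f = 0 := by
      rw [hf, map_prod]
      exact Finset.prod_eq_zero hj (hFr j hj)
    have h2 := aeval_algHom_apply (ι.restrictScalars ℤ) (b j) f
    rw [h1, map_zero] at h2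
    exact h2
  -- common denominator
  have hden : ∃ a : ℕ, 0 < a ∧ ∀ j ∈ s, IsIntegral ℤ ((a : L) * b j) := by
    have h1 : ∀ x : L, IsAlgebraic ℤ x := fun x =>
      (IsFractionRing.isAlgebraic_iff ℤ ℚ L).mpr (Algebra.IsAlgebraic.isAlgebraic x)
    have h2 : ∀ j, ∃ a : ℕ, 0 < a ∧ IsIntegral ℤ ((a : L) * b j) := by
      intro j
      obtain ⟨y, hy0, hy⟩ := (h1 (b j)).exists_integral_multiple
      refine ⟨y.natAbs, Int.natAbs_pos.mpr hy0, ?_⟩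
      rw [zsmul_eq_mul] at hy
      rcases Int.natAbs_eq y with h | h
      · rw [h] at hy; simpa using hy
      · rw [h] at hy; simpa using hy
    choose a ha0 ha using h2
    refine ⟨∏ j ∈ s, a j, Finset.prod_pos fun j _ => ha0 j, fun j hj => ?_⟩
    rw [← Finset.prod_erase_mul s a hj]
    push_cast
    rw [mul_assoc]
    refine IsIntegral.mul ?_ (ha j)
    rw [← Nat.cast_prod]
    exact_mod_cast (isIntegral_algebraMap (R := ℤ) (A := L)
      (x := ((∏ x ∈ s.erase j, a x : ℕ) : ℤ)))
  obtain ⟨a, ha0, ha⟩ := hden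
  obtain ⟨c, hc⟩ := LindemannWeierstrass.exp_polynomial_approx f hf0
  set d := f.natDegree with hd
  set B : ℝ := (a : ℝ) ^ d * c with hB
  have hlim : Filter.Tendsto (fun q : ℕ => ((s.card : ℝ) * B) * (B ^ q / (q.factorial : ℝ)))
      Filter.atTop (nhds 0) := by
    simpa using (FloorSemiring.tendsto_pow_div_factorial_atTop B).const_mul ((s.card : ℝ) * B)
  obtain ⟨Q, hQ⟩ := Filter.eventually_atTop.mp (hlim.eventually (gt_mem_nhds one_pos))
  obtain ⟨p, hpge, hp⟩ := Nat.exists_infinite_primes ((eval 0 f).natAbs + a + k + Q + 2)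
  obtain ⟨n, hn, g, hgdeg, hg⟩ := hc p (by omega) hp
  set T : L := ∑ j ∈ s, aeval (b j) g with hT
  -- `T` is rational
  have hTfix : ∀ σ : L ≃ₐ[ℚ] L, σ T = T := by
    intro σ
    obtain ⟨e, he1, he2⟩ := hinv σ
    rw [hT, map_sum]
    refine Finset.sum_equiv e he1 ?_
    intro j _
    rw [he2]
    exact (aeval_algHom_apply (σ.toAlgHom.restrictScalars ℤ) (b j) g).symm
  have hTint : IsIntegral ℤ ((a : L) ^ (p * d) * T) := by
    rw [hT, Finset.mul_sum]
    refine IsIntegral.sum _ fun j hj => ?_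
    rw [aeval_eq_sum_range, Finset.mul_sum]
    refine IsIntegral.sum _ fun i hi => ?_
    have hi' : i ≤ p * d := by
      have := Finset.mem_range.mp hi
      omega
    obtain ⟨m, hm⟩ := Nat.exists_eq_add_of_le hi'
    have hcast : ∀ z : ℤ, IsIntegral ℤ (z : L) := fun z =>
      isIntegral_algebraMap (R := ℤ) (A := L) (x := z)
    have : (a : L) ^ (p * d) * (g.coeff i • b j ^ i)
        = (((a : ℤ) ^ m * g.coeff i : ℤ) : L) * ((a : L) * b j) ^ i := by
      rw [hm, zsmul_eq_mul]
      push_cast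
      ring
    rw [this]
    exact (hcast _).mul ((ha j hj).pow i)
  have hTrat : ∃ t : ℚ, algebraMap ℚ L t = T := by
    have := (IsGalois.mem_bot_iff_fixed (F := ℚ) (E := L) T).mpr hTfix
    exact IntermediateField.mem_bot.mp this
  obtain ⟨t, ht⟩ := hTrat
  have hM : ∃ M : ℤ, (M : L) = (a : L) ^ (p * d) * T := by
    have h1 : algebraMap ℚ L ((a : ℚ) ^ (p * d) * t) = (a : L) ^ (p * d) * T := by
      rw [map_mul, ht, map_pow, map_natCast]
    rw [← h1] at hTint
    have h2 : IsIntegral ℤ ((a : ℚ) ^ (p * d) * t) :=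
      (isIntegral_algebraMap_iff (algebraMap ℚ L).injective).mp hTint
    obtain ⟨M, hM⟩ := IsIntegrallyClosed.isIntegral_iff.mp h2
    refine ⟨M, ?_⟩
    rw [← h1, ← hM]
    simp
  obtain ⟨M, hM⟩ := hM
  have hMC : (M : ℂ) = (a : ℂ) ^ (p * d) * ι T := by
    have := congrArg ι hM
    simpa using this
  have hιT : ι T = ∑ j ∈ s, aeval (ι (b j)) g := by
    rw [hT, map_sum]
    refine Finset.sum_congr rfl fun j _ => ?_
    exact (aeval_algHom_apply (ι.restrictScalars ℤ) (b j) g).symm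
  set W : ℤ := (a : ℤ) ^ (p * d) * (n * k) + p * M with hW
  have hWC : (W : ℂ) = -((a : ℂ) ^ (p * d) *
      ∑ j ∈ s, (n • Complex.exp (ι (b j)) - p • aeval (ι (b j)) g)) := by
    have h1 : ∑ j ∈ s, Complex.exp (ι (b j)) = -(k : ℂ) := by
      linear_combination hsum
    rw [Finset.sum_sub_distrib, ← Finset.smul_sum, ← Finset.smul_sum, h1, ← hιT, hW]
    push_cast
    rw [hMC, zsmul_eq_mul, nsmul_eq_mul]
    ring
  have hWlt : |(W : ℝ)| < 1 := by
    have h1 : |(W : ℝ)| = ‖(W : ℂ)‖ := by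
      rw [Complex.norm_intCast]
    rw [h1, hWC, norm_neg, norm_mul, norm_pow, Complex.norm_natCast]
    have h2 : ‖∑ j ∈ s, (n • Complex.exp (ι (b j)) - p • aeval (ι (b j)) g)‖
        ≤ s.card * (c ^ p / ((p - 1).factorial : ℝ)) := by
      refine (norm_sum_le_of_le s fun j hj => hg (hroot j hj)).trans ?_
      rw [Finset.sum_const, nsmul_eq_mul]
    refine (mul_le_mul_of_nonneg_left h2 (by positivity)).trans_lt ?_
    have h3 := hQ (p - 1) (by omega)
    refine lt_of_eq_of_lt ?_ h3
    obtain ⟨q, rfl⟩ : ∃ q, p = q + 1 := ⟨p - 1, by omega⟩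
    rw [hB, Nat.add_sub_cancel]
    ring
  have hW0 : W = 0 := by
    have : |W| < 1 := by exact_mod_cast hWlt
    exact Int.abs_lt_one_iff.mp this
  have hdvd : (p : ℤ) ∣ (a : ℤ) ^ (p * d) * (n * k) :=
    ⟨-M, by linear_combination hW0⟩
  have hpp : Prime (p : ℤ) := Nat.prime_iff_prime_int.mp hp
  rcases hpp.dvd_or_dvd hdvd with h | h
  · have h1 : p ∣ a := by exact_mod_cast hpp.dvd_of_dvd_pow h
    have := Nat.le_of_dvd ha0 h1
    omega
  · rcases hpp.dvd_or_dvd h with h | h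
    · exact hn h
    · have h1 : p ∣ k := by exact_mod_cast h
      have := Nat.le_of_dvd hk h1
      omega

theorem exp_ne_neg_one_of_galois {L : Type*} [Field L] [Algebra ℚ L] [FiniteDimensional ℚ L]
    [IsGalois ℚ L] (ι : L →ₐ[ℚ] ℂ) (x : L) : Complex.exp (ι x) ≠ -1 := by
  classical
  intro hx
  let G := L ≃ₐ[ℚ] L
  let b : Finset G → L := fun S => ∑ σ ∈ S, σ x
  have hprod : ∏ σ : G, (1 + Complex.exp (ι (σ x))) = 0 :=
    Finset.prod_eq_zero (Finset.mem_univ (1 : G)) (by rw [AlgEquiv.one_apply, hx]; ring)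
  rw [Finset.prod_one_add] at hprod
  have hsum : ∑ S : Finset G, Complex.exp (ι (b S)) = 0 := by
    rw [← hprod, Finset.powerset_univ]
    refine Finset.sum_congr rfl fun S _ => ?_
    rw [map_sum, Complex.exp_sum]
  rw [← Finset.sum_filter_add_sum_filter_not Finset.univ (fun S => b S = 0)] at hsum
  refine lindemann_core ι (Finset.univ.filter fun S => ¬ b S = 0) b ?_ ?_
    (Finset.univ.filter fun S => b S = 0).card ?_ ?_
  · intro S hS
    exact (Finset.mem_filter.mp hS).2
  · intro σ
    have hb : ∀ S, b ((Equiv.mulLeft σ).finsetCongr S) = σ (b S) := by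
      intro S
      simp only [b, Equiv.finsetCongr_apply, Finset.sum_map, map_sum]
      rfl
    refine ⟨(Equiv.mulLeft σ).finsetCongr, fun S => ?_, hb⟩
    simp only [Finset.mem_filter, Finset.mem_univ, true_and]
    rw [hb]
    simp
  · exact Finset.card_pos.mpr ⟨∅, by simp [b]⟩
  · rw [← hsum]
    congr 1
    rw [Finset.sum_congr rfl (g := fun _ => (1 : ℂ))]
    · simp
    · intro S hS
      rw [(Finset.mem_filter.mp hS).2]
      simp

theorem two_pi_I_not_algebraic : ¬ IsAlgebraic ℚ (2 * (Real.pi : ℂ) * Complex.I) := by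
  intro h
  have hα : IsAlgebraic ℚ ((Real.pi : ℂ) * Complex.I) := by
    have h2 : IsAlgebraic ℚ (algebraMap ℚ ℂ (1 / 2)) := isAlgebraic_algebraMap _
    have h3 := h2.mul h
    have h4 : algebraMap ℚ ℂ (1 / 2) * (2 * (Real.pi : ℂ) * Complex.I)
        = (Real.pi : ℂ) * Complex.I := by
      rw [map_div₀, map_one, map_ofNat]
      ring
    rwa [h4] at h3
  set α : ℂ := (Real.pi : ℂ) * Complex.I with hαdef
  let N := IntermediateField.adjoin ℚ ((minpoly ℚ α).rootSet ℂ)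
  have hne : minpoly ℚ α ≠ 0 := minpoly.ne_zero hα.isIntegral
  have hmem : α ∈ N :=
    IntermediateField.subset_adjoin _ _ (mem_rootSet.mpr ⟨hne, minpoly.aeval ℚ α⟩)
  letI instA : Algebra ℚ N := N.algebra'
  have hsf : @IsSplittingField ℚ N _ _ instA (minpoly ℚ α) :=
    IntermediateField.adjoin_rootSet_isSplittingField (IsAlgClosed.splits _)
  have hnorm : @Normal ℚ N _ _ instA := Normal.of_isSplittingField (minpoly ℚ α)
  have hfin : @FiniteDimensional ℚ N _ _ instA.toModule :=
    IsSplittingField.finiteDimensional N (minpoly ℚ α)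
  have hgal : @IsGalois ℚ _ N _ instA := @IsGalois.mk ℚ _ N _ instA inferInstance hnorm
  exact @exp_ne_neg_one_of_galois N _ instA hfin hgal N.val ⟨α, hmem⟩
    (by simp [hαdef, Complex.exp_pi_mul_I])

/-- If `n • (2πi)` lies in `ℚ̄`, then `n = 0`. -/
theorem int_eq_zero_of_mul_two_pi_I (n : ℤ) (x : ↥Qbar)
    (h : (n : ℂ) * (2 * (Real.pi : ℂ) * Complex.I) = (x : ℂ)) : n = 0 := by
  by_contra hn
  apply two_pi_I_not_algebraic
  have hx : IsAlgebraic ℚ (x : ℂ) := mem_algebraicClosure_iff.mp x.2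
  have h1 : IsAlgebraic ℚ (algebraMap ℚ ℂ ((n : ℚ)⁻¹)) := isAlgebraic_algebraMap _
  have h2 := h1.mul hx
  rw [← h] at h2
  have hnC : (n : ℂ) ≠ 0 := by exact_mod_cast hn
  have h3 : algebraMap ℚ ℂ ((n : ℚ)⁻¹) * ((n : ℂ) * (2 * (Real.pi : ℂ) * Complex.I))
      = 2 * (Real.pi : ℂ) * Complex.I := by
    rw [map_inv₀, map_intCast, inv_mul_cancel_left₀ hnC]
  rwa [h3] at h2

/-- The compatibility condition for a morphism `ℤ(q) → ℤ(r)` read off in `ℂ`. -/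
theorem Zt_hom_compat (q r : ℤ) (φ : PeriodModHom (Zt q) (Zt r)) :
    ∃ (n : ℤ) (x : ↥Qbar), (x : ℂ) * (2 * (Real.pi : ℂ) * Complex.I) ^ q =
      (n : ℂ) * (2 * (Real.pi : ℂ) * Complex.I) ^ r ∧
      (n = 0 → φ.φZ = 0) ∧ (x = 0 → φ.φK = 0) := by
  let φZ : ℤ →+ ℤ := φ.φZ
  let φK : ↥Qbar →ₗ[↥Qbar] ↥Qbar := φ.φK
  refine ⟨φZ 1, φK 1, ?_, ?_, ?_⟩
  · have h : TensorProduct.map φK (LinearMap.id : ℂ →ₗ[↥Qbar] ℂ)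
        (zmultiplesHom _ ((1 : ↥Qbar) ⊗ₜ[↥Qbar] ((2 * (Real.pi : ℂ) * Complex.I) ^ q)) (1 : ℤ)) =
        zmultiplesHom _ ((1 : ↥Qbar) ⊗ₜ[↥Qbar] ((2 * (Real.pi : ℂ) * Complex.I) ^ r)) (φZ 1) :=
      φ.compat (1 : ℤ)
    rw [zmultiplesHom_apply, zmultiplesHom_apply, one_zsmul, TensorProduct.map_tmul] at h
    have h' := congrArg (TensorProduct.lid ↥Qbar ℂ) h
    rw [map_zsmul, TensorProduct.lid_tmul, TensorProduct.lid_tmul, one_smul, zsmul_eq_mul] at h'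
    exact h'
  · intro h
    have : φZ = 0 := by ext; simpa using h
    exact this
  · intro h
    have : φK = 0 := by ext; simpa using h
    exact this

end PiTranscendental

/-- Over `K = ℚ̄`, any morphism `ℤ(0) → ℤ(1)` in `Mod_{ℤ,K}` is zero, and similarly any
morphism `ℤ(1) → ℤ(0)` is zero. -/
theorem stmt_8 :
    (∀ φ : PeriodModHom (Zt 0) (Zt 1), φ.φZ = 0 ∧ φ.φK = 0) ∧
    (∀ φ : PeriodModHom (Zt 1) (Zt 0), φ.φZ = 0 ∧ φ.φK = 0) := by
  have hpi : (2 * (Real.pi : ℂ) * Complex.I) ≠ 0 := Complex.two_pi_I_ne_zero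
  constructor
  · intro φ
    obtain ⟨n, x, h, hn, hx⟩ := Zt_hom_compat 0 1 φ
    rw [zpow_zero, zpow_one, mul_one] at h
    have hn0 : n = 0 := int_eq_zero_of_mul_two_pi_I n x h.symm
    refine ⟨hn hn0, hx ?_⟩
    rw [hn0] at h
    simpa using h
  · intro φ
    obtain ⟨n, x, h, hn, hx⟩ := Zt_hom_compat 1 0 φ
    rw [zpow_zero, zpow_one, mul_one] at h
    have hx0 : x = 0 := by
      by_contra hne
      have hxC : (x : ℂ) ≠ 0 := by simpa using hne
      have h1 : ((1 : ℤ) : ℂ) * (2 * (Real.pi : ℂ) * Complex.I) = ((x⁻¹ * (n : ↥Qbar) : ↥Qbar) : ℂ) := by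
        push_cast
        rw [← h]
        field_simp
      exact one_ne_zero (int_eq_zero_of_mul_two_pi_I 1 _ h1)
    refine ⟨hn ?_, hx hx0⟩
    rw [hx0] at h
    have : (n : ℂ) = 0 := by rw [← h]; simp
    exact_mod_cast this
end

section
/- Let K = ℚ̄ and q ∈ ℤ with q ≠ 0. Then Hom(ℤ(0), ℤ(q)) = 0 in Mod_{ℤ,K}, where ℤ(q) = (ℤ, K, n ↦ n(2πi)^q ⊗ 1). -/
set_option synthInstance.maxHeartbeats 1000000
set_option maxHeartbeats 1000000

open TensorProduct CategoryTheory

variable {K : Type} [Field K] [Algebra K ℂ]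

open Polynomial in
theorem aux_poly {ι : Type*} (s : Finset ι) (b : ι → ℂ) (hb : ∀ i ∈ s, b i ≠ 0)
    (ha : ∀ i ∈ s, IsAlgebraic ℤ (b i)) :
    ∃ f : ℤ[X], f.eval 0 ≠ 0 ∧ ∀ i ∈ s, aeval (b i) f = 0 := by
  classical
  have key : ∀ i : ι, ∃ f : ℤ[X], i ∈ s → f.eval 0 ≠ 0 ∧ aeval (b i) f = 0 := by
    intro i
    by_cases hi : i ∈ s
    · obtain ⟨f, h1, h2⟩ := (ha i hi).exists_nonzero_coeff_and_aeval_eq_zero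
        (mem_nonZeroDivisors_of_ne_zero (hb i hi))
      exact ⟨f, fun _ => ⟨by rwa [← coeff_zero_eq_eval_zero], h2⟩⟩
    · exact ⟨0, fun h => (hi h).elim⟩
  choose f hf using key
  refine ⟨∏ i ∈ s, f i, ?_, ?_⟩
  · rw [eval_prod]
    exact Finset.prod_ne_zero_iff.2 fun i hi => (hf i hi).1
  · intro i hi
    rw [map_prod]
    exact Finset.prod_eq_zero hi (hf i hi).2

open Polynomial in
/-- clearing denominators in a polynomial value -/
theorem aux_integral (d : ℤ) (x : ℂ) (hx : IsIntegral ℤ ((d : ℂ) * x)) (g : ℤ[X]) (N : ℕ)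
    (hN : g.natDegree ≤ N) : IsIntegral ℤ ((d : ℂ) ^ N * aeval x g) := by
  rw [aeval_eq_sum_range, Finset.mul_sum]
  refine IsIntegral.sum _ fun i hi => ?_
  have hi' : i ≤ N := by
    have := Finset.mem_range.1 hi
    omega
  have : (d : ℂ) ^ N * (g.coeff i • x ^ i)
      = ((d ^ (N - i) * g.coeff i : ℤ) : ℂ) * ((d : ℂ) * x) ^ i := by
    have h : (d : ℂ) ^ N = (d : ℂ) ^ (N - i) * (d : ℂ) ^ i := by
      rw [← pow_add]; congr 1; omega
    rw [h, zsmul_eq_mul, mul_pow]; push_cast; ring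
  rw [this]
  exact (isIntegral_algebraMap (R := ℤ) (A := ℂ) (x := d ^ (N - i) * g.coeff i)).mul (hx.pow i)

/-- The contradiction, given rationality of symmetric sums. -/
theorem aux_main {ι : Type*} (s : Finset ι) (b : ι → ℂ) (hb : ∀ i ∈ s, b i ≠ 0)
    (ha : ∀ i ∈ s, IsAlgebraic ℤ (b i)) (k : ℕ) (hk : k ≠ 0)
    (hrat : ∀ g : Polynomial ℤ, ∃ r : ℚ, ∑ i ∈ s, Polynomial.aeval (b i) g = (r : ℂ))
    (hsum : (k : ℂ) + ∑ i ∈ s, Complex.exp (b i) = 0) : False := by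
  obtain ⟨f, hf0, hfb⟩ := aux_poly s b hb ha
  obtain ⟨c, hc⟩ := LindemannWeierstrass.exp_polynomial_approx f hf0
  have hfne : f ≠ 0 := by rintro rfl; simp at hf0
  set d : ℤ := f.leadingCoeff with hd
  have hd0 : d ≠ 0 := by simpa [hd] using hfne
  set m := f.natDegree with hm
  have hint : ∀ i ∈ s, IsIntegral ℤ ((d : ℂ) * b i) := fun i hi => by
    have := isIntegral_leadingCoeff_smul (R := ℤ) (p := f) (x := b i) (hfb i hi)
    rwa [zsmul_eq_mul] at this
  set C : ℝ := |c| * |(d : ℝ)| ^ m with hC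
  have hlim : Filter.Tendsto (fun n : ℕ => (s.card : ℝ) * C * (C ^ n / (n.factorial : ℝ)))
      Filter.atTop (nhds 0) := by
    simpa using (FloorSemiring.tendsto_pow_div_factorial_atTop C).const_mul ((s.card : ℝ) * C)
  obtain ⟨n0, hn0⟩ := Filter.eventually_atTop.1 (hlim.eventually (gt_mem_nhds one_pos))
  obtain ⟨p, hp, hpp⟩ := Nat.exists_infinite_primes
    (n0 + 1 + (f.eval 0).natAbs + k + d.natAbs + 1)
  obtain ⟨n, hn, g, hg, happ⟩ := hc p (by omega) hpp
  obtain ⟨r, hr⟩ := hrat g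
  set N := p * m with hN
  have hint2 : IsIntegral ℤ ((d : ℂ) ^ N * ∑ i ∈ s, Polynomial.aeval (b i) g) := by
    rw [Finset.mul_sum]
    exact IsIntegral.sum _ fun i hi => aux_integral d _ (hint i hi) g N (by omega)
  obtain ⟨z, hz⟩ : ∃ z : ℤ, (d : ℂ) ^ N * ∑ i ∈ s, Polynomial.aeval (b i) g = (z : ℂ) := by
    rw [hr] at hint2 ⊢
    have h1 : (d : ℂ) ^ N * (r : ℂ) = algebraMap ℚ ℂ ((d : ℚ) ^ N * r) := by simp
    rw [h1, isIntegral_algebraMap_iff (algebraMap ℚ ℂ).injective] at hint2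
    obtain ⟨z, hz⟩ := IsIntegrallyClosed.isIntegral_iff.1 hint2
    refine ⟨z, ?_⟩
    rw [h1, ← hz]; simp
  -- the integer
  set M : ℤ := d ^ N * (n * k) + p * z with hM
  have hM0 : M ≠ 0 := by
    intro h
    have hdvd : (p : ℤ) ∣ d ^ N * (n * k) := by
      have : d ^ N * (n * k) = p * (-z) := by linarith
      exact ⟨_, this⟩
    have hpi : Prime (p : ℤ) := Nat.prime_iff_prime_int.1 hpp
    rcases hpi.dvd_or_dvd hdvd with h | h
    · have := Int.natCast_dvd.1 (hpi.dvd_of_dvd_pow h)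
      have := Nat.le_of_dvd (Int.natAbs_pos.2 hd0) this
      omega
    · rcases hpi.dvd_or_dvd h with h | h
      · exact hn h
      · have := Nat.le_of_dvd (Nat.pos_of_ne_zero hk) (Int.natCast_dvd_natCast.1 h)
        omega
  have hMeq : (M : ℂ) = - ((d : ℂ) ^ N * ∑ i ∈ s,
      (n • Complex.exp (b i) - p • Polynomial.aeval (b i) g)) := by
    rw [Finset.sum_sub_distrib, ← Finset.smul_sum, ← Finset.smul_sum, zsmul_eq_mul, nsmul_eq_mul,
      hM]
    push_cast
    rw [← hz]
    linear_combination (d : ℂ) ^ N * n * hsum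
  have hbound : ‖(M : ℂ)‖ ≤ |(d : ℝ)| ^ N * (s.card * (c ^ p / ((p - 1).factorial : ℝ))) := by
    rw [hMeq, norm_neg, norm_mul, norm_pow, Complex.norm_intCast]
    gcongr
    refine (norm_sum_le _ _).trans ?_
    rw [← nsmul_eq_mul]
    refine Finset.sum_le_card_nsmul _ _ _ fun i hi => happ ?_
    exact (Polynomial.mem_aroots).2 ⟨hfne, hfb i hi⟩
  have h1 : (1 : ℝ) ≤ ‖(M : ℂ)‖ := by
    rw [Complex.norm_intCast]
    exact_mod_cast Int.one_le_abs hM0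
  have h2 := hn0 (p - 1) (by omega)
  have h3 : |(d : ℝ)| ^ N * (s.card * (c ^ p / ((p - 1).factorial : ℝ))) ≤
      (s.card : ℝ) * C * (C ^ (p - 1) / ((p - 1).factorial : ℝ)) := by
    have h4 : C * C ^ (p - 1) = |c| ^ p * |(d : ℝ)| ^ N := by
      rw [← pow_succ', Nat.sub_add_cancel hpp.one_le, hC, mul_pow, ← pow_mul, hN, mul_comm m p]
    have h5 : (s.card : ℝ) * C * (C ^ (p - 1) / ((p - 1).factorial : ℝ)) =
        |(d : ℝ)| ^ N * (s.card * (|c| ^ p / ((p - 1).factorial : ℝ))) := by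
      calc _ = (s.card : ℝ) * (C * C ^ (p - 1)) / ((p - 1).factorial : ℝ) := by ring
        _ = _ := by rw [h4]; ring
    rw [h5]
    have : c ^ p ≤ |c| ^ p := by rw [← abs_pow]; exact le_abs_self _
    gcongr
  linarith

theorem aux_exp (a : Qbar) (ha : Complex.exp (a : ℂ) = -1) : False := by
  classical
  have : IsAlgClosure ℚ Qbar := algebraicClosure.isAlgClosure ℚ ℂ
  have : Normal ℚ Qbar := IsAlgClosure.normal ℚ Qbar
  have : IsGalois ℚ Qbar := ⟨⟩
  have haint : IsIntegral ℚ a := (Algebra.IsAlgebraic.isAlgebraic (R := ℚ) a).isIntegral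
  set P := minpoly ℚ a with hP
  have hP0 : P ≠ 0 := minpoly.ne_zero haint
  set T : Finset Qbar := (P.aroots Qbar).toFinset with hT
  have hmemT : ∀ x, x ∈ T ↔ Polynomial.aeval x P = 0 := fun x => by
    rw [hT, Multiset.mem_toFinset, Polynomial.mem_aroots]; simp [hP0]
  have haT : a ∈ T := (hmemT a).2 (minpoly.aeval ℚ a)
  have hσT : ∀ (σ : Qbar ≃ₐ[ℚ] Qbar) x, x ∈ T → σ x ∈ T := fun σ x hx => by
    rw [hmemT] at hx ⊢
    rw [Polynomial.aeval_algEquiv, AlgHom.comp_apply, hx, map_zero]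
  set bb : Finset Qbar → Qbar := fun S => ∑ x ∈ S, x with hbb
  set s := T.powerset.filter (fun S => bb S ≠ 0) with hs
  set s0 := T.powerset.filter (fun S => ¬ bb S ≠ 0) with hs0
  have hmaps : ∀ (σ : Qbar ≃ₐ[ℚ] Qbar) S, bb (S.map σ.toEquiv.toEmbedding) = σ (bb S) := by
    intro σ S
    simp [hbb, Finset.sum_map]
  have hmems : ∀ (σ : Qbar ≃ₐ[ℚ] Qbar) S, S ∈ s → S.map σ.toEquiv.toEmbedding ∈ s := by
    intro σ S hS
    rw [hs, Finset.mem_filter, Finset.mem_powerset] at hS ⊢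
    refine ⟨?_, ?_⟩
    · intro y hy
      obtain ⟨x, hx, rfl⟩ := Finset.mem_map.1 hy
      exact hσT σ x (hS.1 hx)
    · rw [hmaps]; simpa using hS.2
  refine aux_main s (fun S => (bb S : ℂ)) ?_ ?_ s0.card ?_ ?_ ?_
  · intro S hS
    have := (Finset.mem_filter.1 hS).2
    simpa using this
  · intro S hS
    have h := mem_algebraicClosure_iff.1 (bb S).2
    exact (IsFractionRing.isAlgebraic_iff ℤ ℚ ℂ).2 h
  · rw [Finset.card_ne_zero]
    exact ⟨∅, by simp [hs0, hbb]⟩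
  · intro g
    have hfix : (∑ S ∈ s, Polynomial.aeval (bb S) g) ∈ Set.range (algebraMap ℚ Qbar) := by
      rw [InfiniteGalois.mem_range_algebraMap_iff_fixed]
      intro σ
      rw [map_sum]
      have himg : s.image (fun S => S.map σ.toEquiv.toEmbedding) = s := by
        apply Finset.eq_of_subset_of_card_le
        · intro S hS
          obtain ⟨S', h, rfl⟩ := Finset.mem_image.1 hS
          exact hmems σ S' h
        · rw [Finset.card_image_of_injective _ (Finset.map_injective _)]
      conv_rhs => rw [← himg]
      rw [Finset.sum_image (fun _ _ _ _ h => Finset.map_injective _ h)]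
      refine Finset.sum_congr rfl fun S _ => ?_
      rw [hmaps]
      exact (Polynomial.aeval_algHom_apply ((σ : Qbar →ₐ[ℚ] Qbar).restrictScalars ℤ) (bb S) g).symm
    obtain ⟨r, hr⟩ := hfix
    refine ⟨r, ?_⟩
    have h := congrArg (algebraMap Qbar ℂ) hr
    rw [map_sum, ← IsScalarTower.algebraMap_apply] at h
    rw [← eq_ratCast (algebraMap ℚ ℂ) r, h]
    refine Finset.sum_congr rfl fun S _ => ?_
    exact Polynomial.aeval_algebraMap_apply ℂ (bb S) g
  · have hprod : ∏ x ∈ T, (1 + Complex.exp (x : ℂ)) = 0 :=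
      Finset.prod_eq_zero haT (by rw [ha]; ring)
    rw [Finset.prod_one_add] at hprod
    have h1 : ∀ S : Finset Qbar, ∏ x ∈ S, Complex.exp (x : ℂ) = Complex.exp (bb S : ℂ) := by
      intro S
      rw [← Complex.exp_sum, hbb]
      congr 1
      exact (map_sum (algebraMap Qbar ℂ) _ _).symm
    simp_rw [h1] at hprod
    rw [← Finset.sum_filter_add_sum_filter_not _ (fun S => bb S ≠ 0), ← hs, ← hs0] at hprod
    have h2 : ∑ S ∈ s0, Complex.exp (bb S : ℂ) = s0.card := by
      rw [Finset.sum_congr rfl (g := fun _ => (1 : ℂ))]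
      · simp
      · intro S hS
        have : bb S = 0 := not_not.1 (Finset.mem_filter.1 hS).2
        rw [this]; simp
    rw [h2] at hprod
    rw [add_comm]; exact hprod

theorem aux_pow (q : ℤ) (hq : q ≠ 0) : ¬ IsAlgebraic ℚ ((2 * (Real.pi : ℂ) * Complex.I) ^ q) := by
  intro h
  have hz : IsAlgebraic ℚ (2 * (Real.pi : ℂ) * Complex.I) := by
    have hn : 0 < q.natAbs := Int.natAbs_pos.2 hq
    rcases Int.natAbs_eq q with e | e
    · rw [e, zpow_natCast] at h
      exact IsAlgebraic.of_pow hn h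
    · rw [e, zpow_neg, zpow_natCast] at h
      exact IsAlgebraic.of_pow hn (by simpa using h.inv)
  have h2 : ((Real.pi : ℂ) * Complex.I) ∈ Qbar := by
    have : ((Real.pi : ℂ) * Complex.I) = (2 : ℂ)⁻¹ * (2 * (Real.pi : ℂ) * Complex.I) := by ring
    rw [this]
    exact mul_mem (inv_mem (ofNat_mem _ 2)) (mem_algebraicClosure_iff.2 hz)
  exact aux_exp ⟨_, h2⟩ Complex.exp_pi_mul_I

/-- Over `K = ℚ̄`, `Hom(ℤ(0), ℤ(q)) = 0` in `Mod_{ℤ,K}` for every `q ≠ 0`. -/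
theorem stmt_9 (q : ℤ) (hq : q ≠ 0) :
    ∀ φ : PeriodModHom (Zt 0) (Zt q), φ.φZ = 0 ∧ φ.φK = 0 := by
  intro φ
  let f : ℤ →+ ℤ := φ.φZ
  let F : Qbar →ₗ[Qbar] Qbar := φ.φK
  have hc : TensorProduct.map F (LinearMap.id : ℂ →ₗ[Qbar] ℂ)
      (zmultiplesHom _ ((1 : ↥Qbar) ⊗ₜ[↥Qbar] ((2 * (Real.pi : ℂ) * Complex.I) ^ (0 : ℤ))) (1 : ℤ))
      = zmultiplesHom _ ((1 : ↥Qbar) ⊗ₜ[↥Qbar] ((2 * (Real.pi : ℂ) * Complex.I) ^ q)) (f 1) :=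
    φ.compat (1 : ℤ)
  have hc2 := congrArg (TensorProduct.lid Qbar ℂ) hc
  simp only [zmultiplesHom_apply, one_smul, zpow_zero, TensorProduct.map_tmul, LinearMap.id_apply,
    TensorProduct.lid_tmul, map_zsmul] at hc2
  rw [zsmul_eq_mul] at hc2
  have hc3 : ((F 1 : Qbar) : ℂ) = (f 1 : ℂ) * (2 * (Real.pi : ℂ) * Complex.I) ^ q := by
    rw [← hc2, Algebra.smul_def, mul_one]; rfl
  have hf1 : f 1 = 0 := by
    by_contra hne
    refine aux_pow q hq ?_
    have hne' : (f 1 : ℂ) ≠ 0 := by exact_mod_cast hne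
    have h : (2 * (Real.pi : ℂ) * Complex.I) ^ q = (f 1 : ℂ)⁻¹ * ((F 1 : Qbar) : ℂ) := by
      rw [hc3]; field_simp
    rw [h]
    exact mem_algebraicClosure_iff.1 (mul_mem (inv_mem (intCast_mem _ _)) (F 1).2)
  have hF1 : F 1 = 0 := by
    rw [hf1] at hc3
    apply Subtype.ext
    simpa using hc3
  constructor
  · have : f = 0 := by ext; simpa using hf1
    exact this
  · have : F = 0 := by ext; simp [hF1]
    exact this
end

section
/- Hermite–Lindemann: if α is a nonzero algebraic number, then e^α is transcendental. Consequently, for the algebraic group G = G_m^d over ℚ̄, if 0 ≠ x ∈ Lie(G)(ℚ̄) = ℚ̄^d, then exp(x) = (e^{x_1},…,e^{x_d}) ∈ (ℂ^*)^d has at least one transcendental coordinate; in particular Lie(G)(ℚ̄) ∩ ker(exp) = {0} inside ℂ^d. -/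
open Complex
open Polynomial in
lemma HL_denom {K : Type*} [Field K] (d : ℤ) (s : K) (hs : IsIntegral ℤ (d • s)) (g : ℤ[X]) (M : ℕ)
    (hM : g.natDegree ≤ M) : IsIntegral ℤ ((d : K) ^ M * aeval s g) := by
  rw [aeval_eq_sum_range, Finset.mul_sum]
  refine IsIntegral.sum _ fun i hi => ?_
  have hi' : i ≤ M := (Nat.lt_succ_iff.mp (Finset.mem_range.mp hi)).trans hM
  have : (d : K) ^ M * (g.coeff i • s ^ i) = ((g.coeff i * d ^ (M - i) : ℤ) : K) * (d • s) ^ i := by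
    obtain ⟨k, rfl⟩ := Nat.exists_eq_add_of_le hi'
    simp only [zsmul_eq_mul, Nat.add_sub_cancel_left]
    push_cast
    ring
  rw [this]
  exact (isIntegral_algebraMap (R := ℤ) (A := K) (x := g.coeff i * d ^ (M - i))).mul (hs.pow i)

lemma HL_small (B C : ℝ) : ∃ N : ℕ, ∀ p ≥ N, B * (C ^ p / (p - 1).factorial) < 1 := by
  have h := FloorSemiring.tendsto_pow_div_factorial_atTop C
  have h2 := (h.const_mul (B * C))
  rw [mul_zero] at h2
  obtain ⟨N, hN⟩ := Filter.eventually_atTop.mp (h2.eventually (gt_mem_nhds one_pos))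
  refine ⟨N + 1, fun p hp => ?_⟩
  obtain ⟨k, rfl⟩ : ∃ k, p = k + 1 := ⟨p - 1, by omega⟩
  have := hN k (by omega)
  rw [Nat.add_sub_cancel, pow_succ]
  calc _ = B * C * (C ^ k / k.factorial) := by ring
    _ < 1 := this

open Polynomial in
lemma HL_core {K : Type*} [Field K] [Algebra ℚ K] [FiniteDimensional ℚ K] [IsGalois ℚ K]
    (ι : K →+* ℂ) (H : K →₀ ℤ) (hinv : ∀ (σ : K ≃ₐ[ℚ] K) (s : K), H (σ s) = H s)
    (h0 : H 0 ≠ 0) (hE : ∑ s ∈ H.support, (H s : ℂ) * Complex.exp (ι s) = 0) : False := by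
  classical
  have : CharZero K := algebraRat.charZero K
  have halg : ∀ s : K, IsAlgebraic ℤ s := fun s =>
    (IsFractionRing.isAlgebraic_iff ℤ ℚ K).mpr (Algebra.IsAlgebraic.isAlgebraic s)
  set S := H.support.erase 0 with hS
  have hf : ∀ s : K, s ≠ 0 → ∃ q : ℤ[X], q.coeff 0 ≠ 0 ∧ aeval s q = 0 := fun s hs =>
    (halg s).exists_nonzero_coeff_and_aeval_eq_zero (mem_nonZeroDivisors_of_ne_zero hs)
  choose! F hF0 hFs using hf
  set f : ℤ[X] := ∏ s ∈ S, F s with hfdef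
  have hf0 : f.eval 0 ≠ 0 := by
    rw [hfdef, eval_prod]
    refine Finset.prod_ne_zero_iff.mpr fun s hs => ?_
    rw [← coeff_zero_eq_eval_zero]
    exact hF0 s (Finset.ne_of_mem_erase hs)
  have hfne : f ≠ 0 := by rintro h; simp [h] at hf0
  have hroot : ∀ s ∈ S, ι s ∈ f.aroots ℂ := by
    intro s hs
    rw [mem_aroots]
    refine ⟨hfne, ?_⟩
    have h1 : aeval s f = 0 := by
      rw [hfdef, map_prod]
      exact Finset.prod_eq_zero hs (hFs s (Finset.ne_of_mem_erase hs))
    have := aeval_algHom_apply ι.toIntAlgHom s f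
    rw [h1, map_zero] at this
    exact this
  obtain ⟨d, hd0, hd⟩ := exists_integral_multiples ℤ ℚ S
  obtain ⟨c, hc⟩ := LindemannWeierstrass.exp_polynomial_approx f hf0
  set D := f.natDegree
  set B : ℝ := ∑ s ∈ S, |(H s : ℝ)| with hB
  obtain ⟨N, hN⟩ := HL_small B (|(d : ℝ)| ^ D * c)
  obtain ⟨p, hpN, hp⟩ := Nat.exists_infinite_primes
    (N + (eval 0 f).natAbs + d.natAbs + (H 0).natAbs + 1)
  obtain ⟨n, hn, g, hg, hgr⟩ := hc p (by omega) hp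
  have hpi : Prime (p : ℤ) := Nat.prime_iff_prime_int.mp hp
  have hnd : ∀ z : ℤ, z ≠ 0 → z.natAbs < p → ¬ (p : ℤ) ∣ z := by
    intro z hz hlt hdv
    exact absurd (Nat.le_of_dvd (Int.natAbs_pos.mpr hz) (Int.natCast_dvd.mp hdv)) (by omega)
  -- the Galois-invariant sum
  set T : K := ∑ s ∈ S, (H s : K) * ((d : K) ^ (p * D) * aeval s g) with hT
  have hTint : IsIntegral ℤ T := by
    refine IsIntegral.sum _ fun s hs => ?_
    refine (isIntegral_algebraMap (R := ℤ) (A := K) (x := H s)).mul ?_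
    exact HL_denom d s (hd s hs) g _ (hg.trans (Nat.sub_le _ _))
  have hTfix : ∀ σ : K ≃ₐ[ℚ] K, σ T = T := by
    intro σ
    rw [hT, map_sum]
    refine Finset.sum_bij (fun s _ => σ s) ?_ ?_ ?_ ?_
    · intro s hs
      simp only [hS, Finset.mem_erase, Finsupp.mem_support_iff] at hs ⊢
      rw [hinv]
      exact ⟨by simpa using hs.1, hs.2⟩
    · intro a _ b _ h
      exact σ.injective h
    · intro s hs
      refine ⟨σ.symm s, ?_, by simp⟩
      simp only [hS, Finset.mem_erase, Finsupp.mem_support_iff] at hs ⊢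
      rw [hinv]
      exact ⟨by simpa using hs.1, hs.2⟩
    · intro s hs
      have := aeval_algHom_apply (σ : K →+* K).toIntAlgHom s g
      have h2 : aeval (σ s) g = σ (aeval s g) := this
      rw [hinv, h2]
      simp
  have hTbot := (IsGalois.mem_bot_iff_fixed (F := ℚ) (E := K) T).mpr hTfix
  obtain ⟨t, ht⟩ := IntermediateField.mem_bot.mp hTbot
  have htint : IsIntegral ℤ t := by
    rw [← ht] at hTint
    exact (isIntegral_algebraMap_iff (algebraMap ℚ K).injective).mp hTint
  obtain ⟨z, hz⟩ := IsIntegrallyClosed.isIntegral_iff.mp htint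
  have hTz : T = (z : K) := by rw [← ht, ← hz]; simp
  have hTC : (z : ℂ) = ∑ s ∈ S, (H s : ℂ) * ((d : ℂ) ^ (p * D) * aeval (ι s) g) := by
    have : ι T = z := by rw [hTz]; simp
    rw [← this, hT, map_sum]
    refine Finset.sum_congr rfl fun s hs => ?_
    have h2 : aeval (ι s) g = ι (aeval s g) := aeval_algHom_apply ι.toIntAlgHom s g
    rw [h2]; simp
  set m : ℤ := d ^ (p * D) * n * H 0 + p * z with hm
  have hmp : ¬ (p : ℤ) ∣ m := by
    rw [hm, dvd_add_left (dvd_mul_right _ _)]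
    intro h
    rcases hpi.dvd_or_dvd h with h | h
    · rcases hpi.dvd_or_dvd h with h | h
      · exact hnd d hd0 (by omega) (hpi.dvd_of_dvd_pow h)
      · exact hn h
    · exact hnd _ h0 (by omega) h
  have hm0 : m ≠ 0 := by rintro h; simp [h] at hmp
  have hm1 : (1 : ℝ) ≤ ‖(m : ℂ)‖ := by
    rw [Complex.norm_intCast]
    exact_mod_cast Int.one_le_abs hm0
  have hE2 : (H 0 : ℂ) = - ∑ s ∈ S, (H s : ℂ) * Complex.exp (ι s) := by
    rw [← Finset.add_sum_erase _ _ (Finsupp.mem_support_iff.mpr h0)] at hE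
    simp only [map_zero, Complex.exp_zero, mul_one] at hE
    linear_combination hE
  have hmC : (m : ℂ) = ∑ s ∈ S, -((H s : ℂ) * (d : ℂ) ^ (p * D) *
      (n • Complex.exp (ι s) - p • aeval (ι s) g)) := by
    rw [hm]
    push_cast
    rw [hTC, hE2, mul_neg, Finset.mul_sum, Finset.mul_sum, ← Finset.sum_neg_distrib,
      ← Finset.sum_add_distrib]
    refine Finset.sum_congr rfl fun s hs => ?_
    simp only [zsmul_eq_mul, nsmul_eq_mul]
    ring
  have hle : ‖(m : ℂ)‖ ≤ B * ((|(d : ℝ)| ^ D * c) ^ p / (p - 1).factorial) := by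
    rw [hmC, hB, Finset.sum_mul]
    refine norm_sum_le_of_le _ fun s hs => ?_
    rw [norm_neg, norm_mul, norm_mul, norm_pow, Complex.norm_intCast, Complex.norm_intCast]
    calc |(H s : ℝ)| * |(d : ℝ)| ^ (p * D) * ‖n • Complex.exp (ι s) - p • aeval (ι s) g‖
        ≤ |(H s : ℝ)| * |(d : ℝ)| ^ (p * D) * (c ^ p / (p - 1).factorial) :=
          mul_le_mul_of_nonneg_left (hgr (hroot s hs)) (by positivity)
      _ = _ := by rw [mul_pow, ← pow_mul, mul_comm D p]; ring
  exact absurd (hm1.trans hle) (not_le.mpr (hN p (by omega)))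

open Polynomial in
lemma HL_field {K : Type*} [Field K] [Algebra ℚ K] [FiniteDimensional ℚ K] [IsGalois ℚ K]
    (ι : K →+* ℂ) (a : K) (ha : a ≠ 0) (P : ℤ[X]) (hP : P ≠ 0)
    (hPe : aeval (Complex.exp (ι a)) P = 0) : False := by
  classical
  have : CharZero K := algebraRat.charZero K
  let E : (AddMonoidAlgebra ℤ K) →ₐ[ℤ] ℂ := AddMonoidAlgebra.lift ℤ ℂ K
    { toFun := fun s => Complex.exp (ι s.toAdd)
      map_one' := by simp
      map_mul' := fun x y => by simp [Complex.exp_add] }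
  have hEs : ∀ s : K, E (AddMonoidAlgebra.single s 1) = Complex.exp (ι s) := by
    intro s
    simp [E]
  let act : (K ≃ₐ[ℚ] K) → (AddMonoidAlgebra ℤ K) ≃ₐ[ℤ] (AddMonoidAlgebra ℤ K) := fun σ =>
    AddMonoidAlgebra.domCongr ℤ ℤ (σ.toRingEquiv.toAddEquiv)
  have hact_single : ∀ σ s (c : ℤ), act σ (AddMonoidAlgebra.single s c) =
      AddMonoidAlgebra.single (σ s) c := fun σ s c => AddMonoidAlgebra.domCongr_single ..
  have hact_coeff : ∀ σ (x : (AddMonoidAlgebra ℤ K)) s, (act σ x).coeff (σ s) = x.coeff s := by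
    intro σ x s
    refine (AddMonoidAlgebra.coeff_domCongr ..).trans ?_
    congr 1
    exact σ.symm_apply_apply s
  have hact_mul : ∀ σ τ (x : (AddMonoidAlgebra ℤ K)), act σ (act τ x) = act (σ * τ) x := by
    intro σ τ x
    ext s
    obtain ⟨s, rfl⟩ := (σ * τ).surjective s
    rw [hact_coeff, AlgEquiv.mul_apply, hact_coeff, hact_coeff]
  let F : (AddMonoidAlgebra ℤ K) := aeval (AddMonoidAlgebra.single a (1 : ℤ) : (AddMonoidAlgebra ℤ K)) P
  have hF0 : F ≠ 0 := by
    intro h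
    have h1 : F.coeff (P.natDegree • a) = P.leadingCoeff := by
      simp only [F, aeval_eq_sum_range, AddMonoidAlgebra.coeff_sum, AddMonoidAlgebra.single_pow,
        Finsupp.finsetSum_apply]
      rw [Finset.sum_eq_single P.natDegree]
      · simp [AddMonoidAlgebra.coeff_smul]
      · intro j _ hj
        simp [AddMonoidAlgebra.coeff_smul, Finsupp.single_apply, ha, hj]
      · simp
    rw [h] at h1
    exact hP (leadingCoeff_eq_zero.mp h1.symm)
  have hEF : E F = 0 := by
    rw [← hPe, ← hEs, aeval_algHom_apply]
  let Nm : (AddMonoidAlgebra ℤ K) := ∏ σ : K ≃ₐ[ℚ] K, act σ F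
  have hN0 : Nm ≠ 0 := by
    refine Finset.prod_ne_zero_iff.mpr fun σ _ => ?_
    simpa using hF0
  have hNact : ∀ σ, act σ Nm = Nm := by
    intro σ
    simp only [Nm, map_prod, hact_mul]
    exact Fintype.prod_equiv (Equiv.mulLeft σ) _ _ (fun τ => rfl)
  have hEN : E Nm = 0 := by
    rw [map_prod]
    refine Finset.prod_eq_zero (Finset.mem_univ 1) ?_
    have : act 1 F = F := by
      ext s
      exact hact_coeff 1 F s
    rw [this, hEF]
  obtain ⟨s, hs⟩ : ∃ s, Nm.coeff s ≠ 0 := by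
    by_contra! h
    exact hN0 (by ext s; exact h s)
  let Q : (AddMonoidAlgebra ℤ K) := ∑ σ : K ≃ₐ[ℚ] K, AddMonoidAlgebra.single (σ (-s)) (1 : ℤ)
  have hQact : ∀ σ, act σ Q = Q := by
    intro σ
    simp only [Q, map_sum, hact_single]
    exact Fintype.sum_equiv (Equiv.mulLeft σ) _ _ (fun τ => rfl)
  let H : (AddMonoidAlgebra ℤ K) := Nm * Q
  have hHact : ∀ σ, act σ H = H := fun σ => by simp only [H, map_mul, hNact, hQact]
  refine HL_core ι H.coeff ?_ ?_ ?_
  · intro σ t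
    conv_lhs => rw [← hHact σ]
    exact hact_coeff σ H t
  · have : H.coeff 0 = Fintype.card (K ≃ₐ[ℚ] K) * Nm.coeff s := by
      simp only [H, Q, Finset.mul_sum, AddMonoidAlgebra.coeff_sum, Finsupp.finsetSum_apply]
      rw [Finset.sum_congr rfl (g := fun _ => Nm.coeff s)]
      · simp
      · intro σ _
        rw [AddMonoidAlgebra.coeff_mul_single_eq_coeff_mul (σ s), mul_one]
        · conv_lhs => rw [← hNact σ]
          exact hact_coeff σ Nm s
        · intro t _
          rw [map_neg, add_neg_eq_zero]
    rw [this]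
    exact mul_ne_zero (by exact_mod_cast Fintype.card_ne_zero) hs
  · have : E H = 0 := by simp only [H, map_mul, hEN, zero_mul]
    rw [← this]
    simp only [E, AddMonoidAlgebra.lift_apply, Finsupp.sum]
    simp

open Polynomial in
lemma HL_main (α : ℂ) (h0 : α ≠ 0) (hα : IsAlgebraic ℚ α) :
    Transcendental ℚ (Complex.exp α) := by
  intro hβ
  obtain ⟨P, hP, hPe⟩ := (IsFractionRing.isAlgebraic_iff ℤ ℚ ℂ).mpr hβ
  have hsp : ((minpoly ℚ α).map (algebraMap ℚ ℂ)).Splits := IsAlgClosed.splits _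
  let L := IntermediateField.adjoin ℚ ((minpoly ℚ α).rootSet ℂ)
  have i1 : IsSplittingField ℚ L (minpoly ℚ α) :=
    IntermediateField.adjoin_rootSet_isSplittingField hsp
  have i2 : FiniteDimensional ℚ L := IsSplittingField.finiteDimensional L (minpoly ℚ α)
  have i3 : IsGalois ℚ L := IsGalois.of_separable_splitting_field
    (minpoly.irreducible hα.isIntegral).separable
  have hm : α ∈ L := IntermediateField.subset_adjoin _ _ (by
    rw [mem_rootSet]
    exact ⟨minpoly.ne_zero hα.isIntegral, minpoly.aeval _ _⟩)
  refine HL_field (K := L) (algebraMap L ℂ) ⟨α, hm⟩ ?_ P hP hPe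
  intro h
  exact h0 (congrArg Subtype.val h)

/-- Hermite–Lindemann: `e^α` is transcendental for a nonzero algebraic `α`. Consequently, for
`G = G_m^d` over `ℚ̄`, a nonzero algebraic vector `x ∈ Lie(G)(ℚ̄) = ℚ̄^d` has `exp(x)` with at
least one transcendental coordinate; in particular `Lie(G)(ℚ̄) ∩ ker(exp) = {0}` in `ℂ^d`. -/
theorem stmt_10 :
    (∀ α : ℂ, α ≠ 0 → IsAlgebraic ℚ α → Transcendental ℚ (Complex.exp α)) ∧
    (∀ (d : ℕ) (x : Fin d → ℂ), (∀ i, IsAlgebraic ℚ (x i)) → x ≠ 0 →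
      ∃ i, Transcendental ℚ (Complex.exp (x i))) ∧
    (∀ (d : ℕ) (x : Fin d → ℂ), (∀ i, IsAlgebraic ℚ (x i)) →
      (∀ i, Complex.exp (x i) = 1) → x = 0) := by
  refine ⟨HL_main, ?_, ?_⟩
  · intro d x hx hne
    obtain ⟨i, hi⟩ := Function.ne_iff.mp hne
    exact ⟨i, HL_main _ hi (hx i)⟩
  · intro d x hx he
    funext i
    by_contra hi
    refine HL_main _ hi (hx i) ?_
    rw [he i]
    exact isAlgebraic_one
end
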